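/- arXiv:1902.05593 — 2 statements merged into one kernel-verified Lean document; each statement's English description precedes it below -/
import Mathlib

section
/- Let X be a two-dimensional real normed space (a Minkowski plane). Then H'_α(X) = 4; that is, there exists a set S of 4 points on the unit sphere of X such that for every pair of distinct x, y ∈ S there is a linear functional f on X with ‖f‖ ≤ 1, 1 < f(x) − f(y), and f(y) ≤ f(z) ≤ f(x) for all z ∈ S, and no such set has more than 4 points. -/
open Metric

noncomputable section

/-- The strict antipodality condition (with gap `> 1`). -/
def StrictAntipProp {X : Type*} [NormedAddCommGroup X] [NormedSpace ℝ X] (S : Set X) : Prop :=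
  ∀ x ∈ S, ∀ y ∈ S, x ≠ y → ∃ f : X →L[ℝ] ℝ, ‖f‖ ≤ 1 ∧
    1 < f x - f y ∧ ∀ z ∈ S, f y ≤ f z ∧ f z ≤ f x

/-- The strict antipodal Hadwiger number `H'_α(X)`. -/
def strictHalpha (X : Type*) [NormedAddCommGroup X] [NormedSpace ℝ X] : ℕ :=
  sSup {k : ℕ | ∃ S : Finset X, S.card = k ∧ (S : Set X) ⊆ sphere (0 : X) 1 ∧
    StrictAntipProp (S : Set X)}

theorem exists_of_functionals {X : Type*} [NormedAddCommGroup X] [NormedSpace ℝ X]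
    (u v : X) (hu : ‖u‖ = 1) (hv : ‖v‖ = 1) (f g : X →L[ℝ] ℝ) (hf : ‖f‖ < 2) (hg : ‖g‖ < 2)
    (hfu : f u = 1) (hfv : f v = 1) (hgu : g u = 1) (hgv : g v = -1) :
    ∃ S : Finset X, S.card = 4 ∧ (S : Set X) ⊆ sphere (0 : X) 1 ∧
      StrictAntipProp (S : Set X) := by
  classical
  have key : ∀ h : X →L[ℝ] ℝ, ‖h‖ < 2 → h u = 1 →
      ∃ a : ℝ, 1 / 2 < a ∧ ‖a • h‖ ≤ 1 := by
    intro h hh h1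
    have hpos : 1 ≤ ‖h‖ := by
      have := h.le_opNorm u
      rw [h1, hu] at this
      simpa using this
    refine ⟨‖h‖⁻¹, ?_, ?_⟩
    · rw [one_div]
      exact inv_strictAnti₀ (by linarith) hh
    · rw [norm_smul, norm_inv, norm_norm, inv_mul_cancel₀ (by linarith)]
  obtain ⟨a, ha, hF⟩ := key f hf hfu
  obtain ⟨b, hb, hG⟩ := key g hg hgu
  obtain ⟨F, rfl⟩ : ∃ F, F = a • f := ⟨_, rfl⟩
  have hFn : ‖-(a • f)‖ ≤ 1 := by rwa [norm_neg]
  have hGn : ‖-(b • g)‖ ≤ 1 := by rwa [norm_neg]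
  have n1 : u ≠ v := by rintro rfl; linarith
  have n2 : u ≠ -u := by intro h; have := congrArg f h; simp [hfu] at this; linarith
  have n3 : u ≠ -v := by intro h; have := congrArg f h; simp [hfu, hfv] at this; linarith
  have n4 : v ≠ -u := by intro h; have := congrArg f h; simp [hfu, hfv] at this; linarith
  have n5 : v ≠ -v := by intro h; have := congrArg f h; simp [hfv] at this; linarith
  have n6 : -u ≠ -v := by simpa using n1
  refine ⟨{u, v, -u, -v}, ?_, ?_, ?_⟩
  · rw [Finset.card_insert_of_notMem, Finset.card_insert_of_notMem,
      Finset.card_insert_of_notMem, Finset.card_singleton]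
    · simpa using n1
    · simp [n4, n5]
    · simp [n1, n2, n3]
  · intro x hx
    simp only [Finset.coe_insert, Finset.coe_singleton, Set.mem_insert_iff,
      Set.mem_singleton_iff] at hx
    rcases hx with rfl | rfl | rfl | rfl <;> simp [hu, hv]
  · intro x hx y hy hxy
    simp only [Finset.coe_insert, Finset.coe_singleton, Set.mem_insert_iff,
      Set.mem_singleton_iff] at hx hy
    have fin : ∀ h : X →L[ℝ] ℝ, ‖h‖ ≤ 1 → 1 < h x - h y →
        (h y ≤ h u ∧ h u ≤ h x) → (h y ≤ h v ∧ h v ≤ h x) →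
        (h y ≤ h (-u) ∧ h (-u) ≤ h x) → (h y ≤ h (-v) ∧ h (-v) ≤ h x) →
        ∃ f : X →L[ℝ] ℝ, ‖f‖ ≤ 1 ∧ 1 < f x - f y ∧
          ∀ z ∈ (({u, v, -u, -v} : Finset X) : Set X), f y ≤ f z ∧ f z ≤ f x := by
      intro h h1 h2 h3 h4 h5 h6
      refine ⟨h, h1, h2, ?_⟩
      intro z hz
      simp only [Finset.coe_insert, Finset.coe_singleton, Set.mem_insert_iff,
        Set.mem_singleton_iff] at hz
      rcases hz with rfl | rfl | rfl | rfl <;> assumption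
    rcases hx with rfl | rfl | rfl | rfl <;> rcases hy with rfl | rfl | rfl | rfl <;>
      first
      | exact absurd rfl hxy
      | (refine fin _ hF ?_ ?_ ?_ ?_ ?_ <;> simp [hfu, hfv] <;> linarith)
      | (refine fin _ hFn ?_ ?_ ?_ ?_ ?_ <;> simp [hfu, hfv] <;> linarith)
      | (refine fin _ hG ?_ ?_ ?_ ?_ ?_ <;> simp [hgu, hgv] <;> linarith)
      | (refine fin _ hGn ?_ ?_ ?_ ?_ ?_ <;> simp [hgu, hgv] <;> linarith)

theorem exists_auerbach (X : Type*) [NormedAddCommGroup X] [NormedSpace ℝ X]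
    [FiniteDimensional ℝ X] (hdim : Module.finrank ℝ X = 2) :
    ∃ (u v : X) (p q : X →L[ℝ] ℝ), ‖u‖ = 1 ∧ ‖v‖ = 1 ∧
      (∀ x, ‖x‖ ≤ 1 → |p x| ≤ 1) ∧ (∀ x, ‖x‖ ≤ 1 → |q x| ≤ 1) ∧
      p u = 1 ∧ p v = 0 ∧ q u = 0 ∧ q v = 1 ∧ ∀ x, x = p x • u + q x • v := by
  have b : Module.Basis (Fin 2) ℝ X := Module.finBasisOfFinrankEq ℝ X hdim
  obtain ⟨c, hc⟩ : ∃ c : X →L[ℝ] ℝ, ∀ x, c x = b.coord 0 x :=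
    ⟨LinearMap.toContinuousLinearMap (b.coord 0), fun x => rfl⟩
  obtain ⟨d, hd⟩ : ∃ d : X →L[ℝ] ℝ, ∀ x, d x = b.coord 1 x :=
    ⟨LinearMap.toContinuousLinearMap (b.coord 1), fun x => rfl⟩
  haveI : ProperSpace X := FiniteDimensional.proper ℝ X
  obtain ⟨⟨u, v⟩, huv, hmax⟩ := ((isCompact_closedBall (0 : X) 1).prod
    (isCompact_closedBall (0 : X) 1)).exists_isMaxOn (⟨(0, 0), by simp⟩)
    (f := fun z : X × X => c z.1 * d z.2 - d z.1 * c z.2) (by fun_prop)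
  simp only [Set.mem_prod, mem_closedBall, dist_zero_right] at huv
  have hM : ∀ x y : X, ‖x‖ ≤ 1 → ‖y‖ ≤ 1 → c x * d y - d x * c y ≤ c u * d v - d u * c v := by
    intro x y hx hy
    exact hmax (a := (x, y)) (by simp [hx, hy])
  obtain ⟨D, hD⟩ : ∃ D, D = c u * d v - d u * c v := ⟨_, rfl⟩
  rw [← hD] at hM
  have hDpos : 0 < D := by
    have hb0 : ‖b 0‖ ≠ 0 := by simpa using b.ne_zero 0
    have hb1 : ‖b 1‖ ≠ 0 := by simpa using b.ne_zero 1
    have := hM (‖b 0‖⁻¹ • b 0) (‖b 1‖⁻¹ • b 1) (by rw [norm_smul]; simp [hb0])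
      (by rw [norm_smul]; simp [hb1])
    simp [hc, hd] at this
    refine lt_of_lt_of_le ?_ this
    positivity
  have hD0 := hDpos.ne'
  have hp : ∀ x, (D⁻¹ • (d v • c - c v • d)) x = D⁻¹ * (c x * d v - d x * c v) := by
    intro x
    change D⁻¹ * (d v * c x - c v * d x) = _
    ring
  have hq : ∀ x, (D⁻¹ • (c u • d - d u • c)) x = D⁻¹ * (c u * d x - d u * c x) := by
    intro x; simp
  generalize (D⁻¹ • (d v • c - c v • d)) = p at hp
  generalize (D⁻¹ • (c u • d - d u • c)) = q at hq
  have hpb : ∀ x, ‖x‖ ≤ 1 → |p x| ≤ 1 := by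
    intro x hx
    have h1 := hM x v hx huv.2
    have h2 := hM (-x) v (by simpa using hx) huv.2
    simp at h2
    rw [hp, inv_mul_eq_div, abs_div, abs_of_pos hDpos, div_le_one hDpos, abs_le]
    constructor <;> linarith
  have hqb : ∀ x, ‖x‖ ≤ 1 → |q x| ≤ 1 := by
    intro x hx
    have h1 := hM u x huv.1 hx
    have h2 := hM u (-x) huv.1 (by simpa using hx)
    simp at h2
    rw [hq, inv_mul_eq_div, abs_div, abs_of_pos hDpos, div_le_one hDpos, abs_le]
    constructor <;> linarith
  have norm1 : ∀ (w : X) (r : X →L[ℝ] ℝ), (∀ x, ‖x‖ ≤ 1 → |r x| ≤ 1) → ‖w‖ ≤ 1 → r w = 1 →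
      ‖w‖ = 1 := by
    intro w r hr hw h1
    refine le_antisymm hw ?_
    have : ‖r‖ ≤ 1 := by
      refine r.opNorm_le_of_unit_norm zero_le_one fun x hx => hr x hx.le
    have h2 := r.le_opNorm w
    rw [h1] at h2
    simp at h2
    nlinarith [norm_nonneg w]
  have hpu : p u = 1 := by rw [hp, ← hD, inv_mul_cancel₀ hD0]
  have hqv : q v = 1 := by rw [hq, ← hD, inv_mul_cancel₀ hD0]
  refine ⟨u, v, p, q, norm1 u p hpb huv.1 hpu, norm1 v q hqb huv.2 hqv, hpb, hqb, hpu, ?_, ?_,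
    hqv, ?_⟩
  · rw [hp]; ring
  · rw [hq]; ring
  · intro x
    apply b.ext_elem
    have e0 : c x = p x * c u + q x * c v := by
      rw [hp, hq]; field_simp; rw [hD]; ring
    have e1 : d x = p x * d u + q x * d v := by
      rw [hp, hq]; field_simp; rw [hD]; ring
    simp only [hc, hd, Module.Basis.coord_apply] at e0 e1
    intro i
    fin_cases i
    · simpa using e0
    · simpa using e1

theorem norm_lt_or_corner {X : Type*} [NormedAddCommGroup X] [NormedSpace ℝ X]
    [FiniteDimensional ℝ X] (u v : X) (p q : X →L[ℝ] ℝ)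
    (hp : ∀ x, ‖x‖ ≤ 1 → |p x| ≤ 1) (hq : ∀ x, ‖x‖ ≤ 1 → |q x| ≤ 1)
    (hx : ∀ x, x = p x • u + q x • v) : ‖p + q‖ < 2 ∨ ‖u + v‖ ≤ 1 := by
  haveI : ProperSpace X := FiniteDimensional.proper ℝ X
  obtain ⟨x, hx1, hmax⟩ := (isCompact_closedBall (0 : X) 1).exists_isMaxOn (⟨0, by simp⟩)
    (f := fun z : X => (p + q) z) (by fun_prop)
  have hx1' : ‖x‖ ≤ 1 := by simpa using hx1
  have hn : ‖p + q‖ ≤ (p + q) x := by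
    refine (p + q).opNorm_le_of_unit_norm ?_ ?_
    · simpa using hmax (a := (0 : X)) (by simp)
    · intro y hy
      have h1 := hmax (a := y) (by simp [hy])
      have h2 := hmax (a := -y) (by simp [hy])
      simp only [Set.mem_ofPred_eq, map_neg] at h1 h2
      rw [Real.norm_eq_abs, abs_le]
      constructor <;> linarith
  by_cases h : (p + q) x < 2
  · left; linarith
  · right
    have h1 := (abs_le.1 (hp x hx1')).2
    have h2 := (abs_le.1 (hq x hx1')).2
    simp only [add_apply, not_lt] at h
    have e1 : p x = 1 := by linarith
    have e2 : q x = 1 := by linarith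
    have := hx x
    rw [e1, e2, one_smul, one_smul] at this
    rwa [← this]

theorem exists_perturb {X : Type*} [NormedAddCommGroup X] [NormedSpace ℝ X]
    (u v : X) (p q : X →L[ℝ] ℝ) (hu : ‖u‖ = 1) (hv : ‖v‖ = 1)
    (hp : ∀ x, ‖x‖ ≤ 1 → |p x| ≤ 1) (hq : ∀ x, ‖x‖ ≤ 1 → |q x| ≤ 1)
    (hpu : p u = 1) (hpv : p v = 0) (hqu : q u = 0) (hqv : q v = 1)
    (hs : ‖u + v‖ ≤ 1) (hd : ‖p - q‖ < 2) :
    ∃ S : Finset X, S.card = 4 ∧ (S : Set X) ⊆ sphere (0 : X) 1 ∧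
      StrictAntipProp (S : Set X) := by
  have hpn : ‖p‖ ≤ 1 := p.opNorm_le_of_unit_norm zero_le_one fun x hx => hp x hx.le
  have hqn : ‖q‖ ≤ 1 := q.opNorm_le_of_unit_norm zero_le_one fun x hx => hq x hx.le
  obtain ⟨e, he0, he1, he⟩ : ∃ e : ℝ, 0 < e ∧ e < 1 ∧ ‖p - q‖ < 2 * (1 - e) := by
    refine ⟨(2 - ‖p - q‖) / 4, by linarith, by linarith [norm_nonneg (p - q)], by linarith⟩
  have nrm : ∀ (a b : X) (r : X →L[ℝ] ℝ), ‖r‖ ≤ 1 → ‖a‖ = 1 → ‖a + b‖ ≤ 1 → r a = 1 → r b = 0 →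
      ‖a + e • b‖ = 1 := by
    intro a b r hr ha hab h1 h2
    apply le_antisymm
    · have : a + e • b = (1 - e) • a + e • (a + b) := by module
      rw [this]
      refine (norm_add_le _ _).trans ?_
      rw [norm_smul, norm_smul, Real.norm_of_nonneg he0.le, Real.norm_of_nonneg (by linarith), ha]
      nlinarith
    · have h3 := r.le_opNorm (a + e • b)
      simp [h1, h2] at h3
      nlinarith [norm_nonneg (a + e • b)]
  refine exists_of_functionals (u + e • v) (v + e • u) (nrm u v p hpn hu hs hpu hpv)
    (nrm v u q hqn hv (by rwa [add_comm]) hqv hqu) ((1 + e)⁻¹ • (p + q)) ((1 - e)⁻¹ • (p - q))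
    ?_ ?_ ?_ ?_ ?_ ?_
  · rw [norm_smul, norm_inv, Real.norm_of_nonneg (by linarith), inv_mul_lt_iff₀ (by linarith)]
    have := norm_add_le p q
    linarith
  · rw [norm_smul, norm_inv, Real.norm_of_nonneg (by linarith), inv_mul_lt_iff₀ (by linarith)]
    linarith
  · simp [hpu, hpv, hqu, hqv]; field_simp
  · simp [hpu, hpv, hqu, hqv]; field_simp; ring
  · simp [hpu, hpv, hqu, hqv]; exact inv_mul_cancel₀ (by linarith)
  · simp [hpu, hpv, hqu, hqv]
    have : 1 - e ≠ 0 := by linarith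
    field_simp; ring

theorem exists_four (X : Type*) [NormedAddCommGroup X] [NormedSpace ℝ X]
    [FiniteDimensional ℝ X] (hdim : Module.finrank ℝ X = 2) :
    ∃ S : Finset X, S.card = 4 ∧ (S : Set X) ⊆ sphere (0 : X) 1 ∧
      StrictAntipProp (S : Set X) := by
  obtain ⟨u, v, p, q, hu, hv, hp, hq, hpu, hpv, hqu, hqv, hx⟩ := exists_auerbach X hdim
  have hpn : ‖p‖ ≤ 1 := p.opNorm_le_of_unit_norm zero_le_one fun x hx => hp x hx.le
  have hqn : ‖q‖ ≤ 1 := q.opNorm_le_of_unit_norm zero_le_one fun x hx => hq x hx.le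
  have hq' : ∀ x, ‖x‖ ≤ 1 → |(-q) x| ≤ 1 := by
    intro x hx; simpa using hq x hx
  have hx' : ∀ x, x = p x • u + (-q) x • (-v) := by
    intro x; simpa using hx x
  rcases norm_lt_or_corner u v p q hp hq hx with h1 | h1 <;>
    rcases norm_lt_or_corner u (-v) p (-q) hp hq' hx' with h2 | h2
  · rw [← sub_eq_add_neg] at h2
    exact exists_of_functionals u v hu hv (p + q) (p - q) h1 h2 (by simp [hpu, hpv, hqu, hqv]) (by simp [hpu, hpv, hqu, hqv])
      (by simp [hpu, hpv, hqu, hqv]) (by simp [hpu, hpv, hqu, hqv])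
  · exact exists_perturb u (-v) p (-q) hu (by simpa using hv) hp hq' hpu (by simp [hpu, hpv, hqu, hqv])
      (by simp [hpu, hpv, hqu, hqv]) (by simp [hpu, hpv, hqu, hqv]) h2 (by simpa using h1)
  · rw [← sub_eq_add_neg] at h2
    exact exists_perturb u v p q hu hv hp hq hpu hpv hqu hqv h1 h2
  · have n1 : ∀ w : X, p w = 1 → ‖w‖ ≤ 1 → ‖w‖ = 1 := by
      intro w hw h
      refine le_antisymm h ?_
      have h3 := p.le_opNorm w
      simp [hw] at h3
      nlinarith [norm_nonneg w]
    exact exists_of_functionals (u + v) (u + -v) (n1 _ (by simp [hpu, hpv, hqu, hqv]) h1) (n1 _ (by simp [hpu, hpv, hqu, hqv]) h2)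
      p q (by linarith) (by linarith) (by simp [hpu, hpv, hqu, hqv]) (by simp [hpu, hpv, hqu, hqv]) (by simp [hpu, hpv, hqu, hqv]) (by simp [hpu, hpv, hqu, hqv])

open MeasureTheory in
theorem card_le_four (X : Type*) [NormedAddCommGroup X] [NormedSpace ℝ X]
    [FiniteDimensional ℝ X] (hdim : Module.finrank ℝ X = 2) (S : Finset X)
    (hS : StrictAntipProp (S : Set X)) : S.card ≤ 4 := by
  classical
  by_cases hspan : affineSpan ℝ (S : Set X) = ⊤
  · letI : MeasurableSpace X := borel X
    haveI : BorelSpace X := ⟨rfl⟩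
    let μ : Measure X := Measure.addHaar
    let P := convexHull ℝ (S : Set X)
    have hcomp : IsCompact P := S.finite_toSet.isCompact_convexHull ℝ
    have hpos : μ P ≠ 0 := by
      have := interior_convexHull_nonempty_iff_affineSpan_eq_top.2 hspan
      exact (Measure.measure_pos_of_nonempty_interior μ this).ne'
    have hfin : μ P ≠ ⊤ := hcomp.measure_lt_top.ne
    let T : X → Set X := fun x => AffineMap.homothety x (1 / 2 : ℝ) '' P
    have hTm : ∀ x, μ (T x) = ENNReal.ofReal (1 / 4) * μ P := by
      intro x
      rw [Measure.addHaar_image_homothety, hdim]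
      norm_num
    have hTmeas : ∀ x, NullMeasurableSet (T x) μ := by
      intro x
      have : IsCompact (T x) := hcomp.image (AffineMap.homothety x (1/2:ℝ)).continuous_of_finiteDimensional
      exact this.isClosed.measurableSet.nullMeasurableSet
    have hTsub : ∀ x ∈ S, T x ⊆ P := by
      rintro x hx _ ⟨y, hy, rfl⟩
      have hxP : x ∈ P := subset_convexHull ℝ _ hx
      rw [AffineMap.homothety_eq_lineMap]
      exact (convex_convexHull ℝ _).lineMap_mem hxP hy ⟨by norm_num, by norm_num⟩
    have hdisj : Set.Pairwise (S : Set X) (Function.onFun (AEDisjoint μ) T) := by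
      intro x hx y hy hxy
      obtain ⟨f, -, hgap, hf⟩ := hS x hx y hy hxy
      have hP : ∀ z ∈ P, f y ≤ f z ∧ f z ≤ f x := by
        have : P ⊆ f ⁻¹' (Set.Icc (f y) (f x)) :=
          convexHull_min (fun z hz => hf z hz)
            ((convex_Icc (f y) (f x)).linear_preimage (f : X →ₗ[ℝ] ℝ))
        intro z hz
        exact this hz
      let H : AffineSubspace ℝ X := AffineSubspace.mk' ((1 / 2 : ℝ) • (x + y)) (LinearMap.ker (f : X →ₗ[ℝ] ℝ))
      have hH : ∀ z, z ∈ H ↔ f z = (f x + f y) / 2 := by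
        intro z
        simp only [H, AffineSubspace.mem_mk', LinearMap.mem_ker]
        simp [sub_eq_zero]
        constructor <;> intro h <;> linarith
      have hHtop : H ≠ ⊤ := by
        intro h
        have : x ∈ H := by rw [h]; trivial
        rw [hH] at this
        linarith
      refine measure_mono_null ?_ (Measure.addHaar_affineSubspace μ H hHtop)
      rintro z ⟨⟨a, ha, h1⟩, ⟨b, hb, h2⟩⟩
      have h1' := congrArg f h1
      have h2' := congrArg f h2
      simp [AffineMap.homothety_apply] at h1' h2'
      change z ∈ H
      rw [hH]
      have := hP a ha
      have := hP b hb
      linarith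
    have hsum : ∑ x ∈ S, μ (T x) ≤ μ P := by
      rw [← measure_biUnion_finset₀ hdisj (fun x _ => hTmeas x)]
      exact measure_mono (Set.iUnion₂_subset hTsub)
    simp only [hTm, Finset.sum_const, nsmul_eq_mul] at hsum
    rw [← mul_assoc] at hsum
    have h1 : (S.card : ENNReal) * ENNReal.ofReal (1 / 4) ≤ 1 := by
      by_contra hlt
      push Not at hlt
      have := ENNReal.mul_lt_mul_left hpos hfin hlt
      rw [one_mul] at this
      exact absurd hsum (not_le.2 this)
    rw [← ENNReal.ofReal_natCast, ← ENNReal.ofReal_mul (by positivity), ENNReal.ofReal_le_one] at h1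
    have : (S.card : ℝ) ≤ 4 := by linarith
    exact_mod_cast this
  · have hcol : Collinear ℝ (S : Set X) := by
      rw [collinear_iff_finrank_le_one]
      by_contra h
      push Not at h
      have hne : (S : Set X).Nonempty := by
        rw [Set.nonempty_iff_ne_empty]
        intro h0
        rw [h0, vectorSpan_empty] at h
        simp at h
      apply hspan
      rw [AffineSubspace.affineSpan_eq_top_iff_vectorSpan_eq_top_of_nonempty ℝ X X hne]
      apply Submodule.eq_top_of_finrank_eq
      apply le_antisymm (Submodule.finrank_le _)
      omega
    by_contra hcard
    push Not at hcard
    obtain ⟨x, y, z, hx, hy, hz, hxy, hxz, hyz⟩ := Finset.two_lt_card_iff.1 (by omega : 2 < S.card)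
    have key : ∀ x ∈ S, ∀ y ∈ S, ∀ z ∈ S, x ≠ y → y ≠ z → ¬ Wbtw ℝ x y z := by
      rintro x hx y hy z hz hxy hyz ⟨t, ⟨ht0, ht1⟩, rfl⟩
      obtain ⟨f, -, hgap, hf⟩ := hS x hx _ hy hxy
      have h := (hf z hz).1
      simp [AffineMap.lineMap_apply] at h hgap
      have : t ≠ 1 := by rintro rfl; simp at hyz
      have : t < 1 := lt_of_le_of_ne ht1 this
      nlinarith
    rcases (hcol.subset (s₁ := {x, y, z}) (by
      intro w hw
      rcases hw with rfl | rfl | rfl <;> assumption)).wbtw_or_wbtw_or_wbtw with h | h | h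
    · exact key x hx y hy z hz hxy hyz h
    · exact key y hy z hz x hx hyz hxz.symm h
    · exact key z hz x hx y hy hxz.symm hxy h

/-- For every Minkowski plane (two-dimensional real normed space) `X`,
`H'_α(X) = 4`: there is a set of `4` points on the unit sphere satisfying the strict
antipodality condition, and no such set has more than `4` points. -/
theorem strictHalpha_of_dim_two (X : Type*) [NormedAddCommGroup X] [NormedSpace ℝ X]
    [FiniteDimensional ℝ X] (hdim : Module.finrank ℝ X = 2) :
    strictHalpha X = 4 ∧
    (∃ S : Finset X, S.card = 4 ∧ (S : Set X) ⊆ sphere (0 : X) 1 ∧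
      StrictAntipProp (S : Set X)) ∧
    (∀ S : Finset X, (S : Set X) ⊆ sphere (0 : X) 1 → StrictAntipProp (S : Set X) →
      S.card ≤ 4) := by
  have hub : ∀ S : Finset X, (S : Set X) ⊆ sphere (0 : X) 1 → StrictAntipProp (S : Set X) →
      S.card ≤ 4 := fun S _ hS => card_le_four X hdim S hS
  refine ⟨?_, exists_four X hdim, hub⟩
  refine IsGreatest.csSup_eq ⟨exists_four X hdim, ?_⟩
  rintro k ⟨S, rfl, h1, h2⟩
  exact hub S h1 h2

end
end

section
/- For every 1 < p < ∞ one has H'_α(ℓ_p^3) = 2³ = 8; that is, there exist 8 points on the unit sphere of ℓ_p^3 forming a bounded and separated antipodal set with some constant d > 1, and 8 is the largest possible cardinality of such a set. -/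
open Metric

noncomputable section

/-- `S` is a bounded and separated antipodal subset of `X` with constant `d`. -/
def IsBSA {X : Type*} [NormedAddCommGroup X] [NormedSpace ℝ X] (S : Set X) (d : ℝ) : Prop :=
  S ⊆ closedBall (0 : X) 1 ∧
    ∀ x ∈ S, ∀ y ∈ S, x ≠ y → ∃ f : X →L[ℝ] ℝ, ‖f‖ ≤ 1 ∧
      d ≤ f x - f y ∧ ∀ z ∈ S, f y ≤ f z ∧ f z ≤ f x

abbrev L3 (p : ℝ) := PiLp (ENNReal.ofReal p) (fun _ : Fin 3 => ℝ)

lemma l3_norm (p : ℝ) (hp : 1 < p) [Fact (1 ≤ ENNReal.ofReal p)] (x : L3 p) :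
    ‖x‖ = (|x 0| ^ p + |x 1| ^ p + |x 2| ^ p) ^ (1 / p) := by
  have h : (ENNReal.ofReal p).toReal = p := ENNReal.toReal_ofReal (by linarith)
  rw [PiLp.norm_eq_sum (by rw [h]; linarith), h]
  simp [Fin.sum_univ_three]

lemma l3_norm_le_one (p : ℝ) (hp : 1 < p) [Fact (1 ≤ ENNReal.ofReal p)] (x : L3 p)
    (h : ∀ i, |x i| ≤ 1 / 3) : ‖x‖ ≤ 1 := by
  rw [l3_norm p hp]
  have key : ∀ i, |x i| ^ p ≤ 1 / 3 := fun i => by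
    have h1 : |x i| ≤ 1 := (h i).trans (by norm_num)
    calc |x i| ^ p ≤ |x i| ^ (1 : ℝ) :=
          Real.rpow_le_rpow_of_exponent_ge' (abs_nonneg _) h1 (by norm_num) hp.le
      _ ≤ 1 / 3 := by simpa using h i
  apply Real.rpow_le_one
  · positivity
  · linarith [key 0, key 1, key 2]
  · positivity

lemma l3_packing (p : ℝ) (hp : 1 < p) [Fact (1 ≤ ENNReal.ofReal p)] (A : Finset (L3 p)) (n : ℕ)
    (hA : ∀ u ∈ A, ‖u‖ ≤ n) (hs : ∀ u ∈ A, ∀ v ∈ A, u ≠ v → 1 < ‖u - v‖) :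
    A.card ≤ (6 * n + 1) ^ 3 := by
  have hc : (Fintype.piFinset (fun _ : Fin 3 => Finset.Icc (-(3 * n : ℤ)) (3 * n))).card
      = (6 * n + 1) ^ 3 := by
    rw [Fintype.card_piFinset]
    simp only [Int.card_Icc, Finset.prod_const, Finset.card_univ, Fintype.card_fin]
    congr 1
    omega
  rw [← hc]
  apply Finset.card_le_card_of_injOn (fun u i => ⌊3 * u i⌋)
  · intro u hu
    simp only [Finset.mem_coe, Fintype.mem_piFinset, Finset.mem_Icc]
    intro i
    have h1 : ‖u i‖ ≤ n := (PiLp.norm_apply_le u i).trans (hA u hu)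
    rw [Real.norm_eq_abs, abs_le] at h1
    constructor
    · apply Int.le_floor.2; push_cast; linarith
    · have : (⌊3 * u i⌋ : ℝ) ≤ ((3 * n : ℤ) : ℝ) := by
        push_cast; linarith [Int.floor_le (3 * u i)]
      exact_mod_cast this
  · intro u hu v hv huv
    by_contra hne
    have := hs u hu v hv hne
    refine absurd (l3_norm_le_one p hp (u - v) fun i => ?_) (not_le.2 this)
    have h2 : ⌊3 * u i⌋ = ⌊3 * v i⌋ := congrFun huv i
    have h3 := Int.abs_sub_lt_one_of_floor_eq_floor h2
    rw [PiLp.sub_apply]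
    rw [abs_lt] at h3
    rw [abs_le]
    constructor <;> linarith

lemma exists_levels {X : Type*} [NormedAddCommGroup X] [NormedSpace ℝ X] (S : Finset X)
    (hS : (S : Set X) ⊆ sphere (0 : X) 1) (h : StrictAntipProp (S : Set X)) (k : ℕ) :
    ∃ A : Finset X, A.card = S.card ^ k ∧ (∀ u ∈ A, ‖u‖ ≤ (2 : ℝ) ^ k - 1) ∧
      (∀ f : X →L[ℝ] ℝ, ∀ m M : ℝ, (∀ z ∈ S, m ≤ f z ∧ f z ≤ M) →
        ∀ u ∈ A, ((2 : ℝ) ^ k - 1) * m ≤ f u ∧ f u ≤ ((2 : ℝ) ^ k - 1) * M) ∧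
      (∀ u ∈ A, ∀ v ∈ A, u ≠ v → 1 < ‖u - v‖) := by
  classical
  induction k with
  | zero => exact ⟨{0}, by simp, by simp, by simp, by simp⟩
  | succ k ih =>
    obtain ⟨A, hc, hn, hf, hs⟩ := ih
    have sep : ∀ x ∈ S, ∀ y ∈ S, ∀ s ∈ A, ∀ t ∈ A, (x, s) ≠ (y, t) →
        1 < ‖((2 : ℝ) ^ k • x + s) - ((2 : ℝ) ^ k • y + t)‖ := by
      intro x hx y hy s hs' t ht hne
      by_cases hxy : x = y
      · subst hxy
        have : s ≠ t := fun e => hne (by rw [e])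
        simpa using hs s hs' t ht this
      · obtain ⟨f, hf1, hf2, hf3⟩ := h x hx y hy hxy
        have h1 := hf f (f y) (f x) (fun z hz => hf3 z hz) s hs'
        have h2 := hf f (f y) (f x) (fun z hz => hf3 z hz) t ht
        have h3 := f.le_of_opNorm_le hf1 (((2 : ℝ) ^ k • x + s) - ((2 : ℝ) ^ k • y + t))
        have h4 := (le_abs_self _).trans h3
        simp only [map_sub, map_add, map_smul, smul_eq_mul] at h4
        nlinarith
    refine ⟨(S ×ˢ A).image (fun q => (2 : ℝ) ^ k • q.1 + q.2), ?_, ?_, ?_, ?_⟩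
    · rw [Finset.card_image_of_injOn, Finset.card_product, hc]
      · ring
      · rintro ⟨x, s⟩ hx ⟨y, t⟩ hy e
        simp only [Finset.coe_product, Set.mem_prod, Finset.mem_coe] at hx hy e
        by_contra hne
        have := sep x hx.1 y hy.1 s hx.2 t hy.2 hne
        rw [e] at this
        simp at this
        linarith
    · intro u hu
      simp only [Finset.mem_image, Finset.mem_product, Prod.exists] at hu
      obtain ⟨x, s, ⟨hx, hs'⟩, rfl⟩ := hu
      have hx1 : ‖x‖ = 1 := by simpa using hS hx
      calc _ ≤ ‖(2 : ℝ) ^ k • x‖ + ‖s‖ := norm_add_le _ _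
        _ ≤ 2 ^ k + (2 ^ k - 1) := by
          rw [norm_smul, hx1]; gcongr
          · simp
          · exact hn s hs'
        _ = _ := by ring
    · intro f m M hmM u hu
      simp only [Finset.mem_image, Finset.mem_product, Prod.exists] at hu
      obtain ⟨x, s, ⟨hx, hs'⟩, rfl⟩ := hu
      have h1 := hf f m M hmM s hs'
      have h2 := hmM x hx
      have h3 : (0 : ℝ) < 2 ^ k := by positivity
      simp only [map_add, map_smul, smul_eq_mul, pow_succ]
      constructor <;> nlinarith
    · intro u hu v hv hne
      simp only [Finset.mem_image, Finset.mem_product, Prod.exists] at hu hv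
      obtain ⟨x, s, ⟨hx, hs'⟩, rfl⟩ := hu
      obtain ⟨y, t, ⟨hy, ht⟩, rfl⟩ := hv
      exact sep x hx y hy s hs' t ht (fun e => hne (by simp only [Prod.mk.injEq] at e; rw [e.1, e.2]))

lemma l3_upper (p : ℝ) (hp : 1 < p) [Fact (1 ≤ ENNReal.ofReal p)] (S : Finset (L3 p))
    (hS : (S : Set (L3 p)) ⊆ sphere (0 : L3 p) 1) (h : StrictAntipProp (S : Set (L3 p))) :
    S.card ≤ 8 := by
  by_contra! hlt
  have key : ∀ k : ℕ, 9 ^ k ≤ 343 * 8 ^ k := by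
    intro k
    obtain ⟨A, hc, hn, -, hs⟩ := exists_levels S hS h k
    have h1 := l3_packing p hp A (2 ^ k) (fun u hu => by
      push_cast; linarith [hn u hu]) hs
    have h2 : 1 ≤ 2 ^ k := Nat.one_le_two_pow
    calc 9 ^ k ≤ S.card ^ k := Nat.pow_le_pow_left hlt k
      _ ≤ (6 * 2 ^ k + 1) ^ 3 := hc ▸ h1
      _ ≤ (7 * 2 ^ k) ^ 3 := Nat.pow_le_pow_left (by omega) 3
      _ = 343 * 8 ^ k := by
        rw [mul_pow, ← pow_mul, mul_comm k 3, pow_mul]; norm_num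
  have := key 60
  norm_num at this

def sg (b : Bool) : ℝ := if b then 1 else -1

lemma bsa_of_frame {X : Type*} [NormedAddCommGroup X] [NormedSpace ℝ X]
    (u : Fin 3 → X) (f : Fin 3 → X →L[ℝ] ℝ) (c : ℝ) (hc : 1 / 2 < c)
    (hf : ∀ i, ‖f i‖ ≤ 1) (hd : ∀ i j, f i (u j) = if i = j then c else 0)
    (hu : ∀ b : Fin 3 → Bool, ‖∑ i, sg (b i) • u i‖ = 1) :
    ∃ S : Finset X, S.card = 8 ∧ (S : Set X) ⊆ sphere 0 1 ∧ ∃ d : ℝ, 1 < d ∧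
      IsBSA (S : Set X) d := by
  classical
  have hfe : ∀ (b : Fin 3 → Bool) i, f i (∑ j, sg (b j) • u j) = sg (b i) * c := by
    intro b i
    simp [map_sum, hd]
  have hb : ∀ b : Bool, -1 ≤ sg b ∧ sg b ≤ 1 := by
    intro b; cases b <;> norm_num [sg]
  refine ⟨Finset.univ.image (fun b : Fin 3 → Bool => ∑ i, sg (b i) • u i), ?_, ?_,
    2 * c, by linarith, ?_, ?_⟩
  · rw [Finset.card_image_of_injective]
    · simp
    · intro a b hab
      funext i
      have h := congrArg (f i) hab
      simp only [hfe] at h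
      have : sg (a i) = sg (b i) := mul_right_cancel₀ (by linarith) h
      revert this
      cases a i <;> cases b i <;> norm_num [sg]
  · intro x hx
    simp only [Finset.coe_image, Finset.coe_univ, Set.image_univ, Set.mem_range] at hx
    obtain ⟨b, rfl⟩ := hx
    simpa using hu b
  · intro x hx
    simp only [Finset.coe_image, Finset.coe_univ, Set.image_univ, Set.mem_range] at hx
    obtain ⟨b, rfl⟩ := hx
    simpa using (hu b).le
  · intro x hx y hy hxy
    simp only [Finset.coe_image, Finset.coe_univ, Set.image_univ, Set.mem_range] at hx hy
    obtain ⟨a, rfl⟩ := hx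
    obtain ⟨b, rfl⟩ := hy
    have : ∃ i, a i ≠ b i := by
      by_contra! hh
      exact hxy (by simp [hh])
    obtain ⟨i, hi⟩ := this
    refine ⟨sg (a i) • f i, ?_, ?_, ?_⟩
    · rw [norm_smul]
      have : ‖sg (a i)‖ = 1 := by cases a i <;> norm_num [sg]
      rw [this, one_mul]; exact hf i
    · simp only [smul_apply, hfe, smul_eq_mul]
      revert hi
      cases a i <;> cases b i <;> norm_num [sg] <;> linarith
    · intro z hz
      simp only [Finset.coe_image, Finset.coe_univ, Set.image_univ, Set.mem_range] at hz
      obtain ⟨e, rfl⟩ := hz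
      simp only [smul_apply, hfe, smul_eq_mul]
      revert hi
      have := hb (e i)
      cases a i <;> cases b i <;> simp [sg] <;> cases e i <;> simp <;> linarith

lemma exists_t (p : ℝ) (hp : 1 < p) (hp2 : p < 2) :
    ∃ t : ℝ, 3 / 2 ≤ t ∧ t < 2 ∧ 3 * (2 * t - 1) ^ p = 2 + (1 + 2 * t) ^ p := by
  let g : ℝ → ℝ := fun t => 3 * (2 * t - 1) ^ p - 2 - (1 + 2 * t) ^ p
  have hp0 : 0 ≤ p := by linarith
  have hg : Continuous g := by
    have h1 : Continuous fun t : ℝ => (2 * t - 1) ^ p :=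
      (by fun_prop : Continuous fun t : ℝ => 2 * t - 1).rpow_const (fun _ => Or.inr hp0)
    have h2 : Continuous fun t : ℝ => (1 + 2 * t) ^ p :=
      (by fun_prop : Continuous fun t : ℝ => 1 + 2 * t).rpow_const (fun _ => Or.inr hp0)
    exact ((continuous_const.mul h1).sub continuous_const).sub h2
  have ha : g (3 / 2) ≤ 0 := by
    have h4 : (4 : ℝ) ^ p = 2 ^ p * 2 ^ p := by
      rw [← Real.mul_rpow (by norm_num) (by norm_num)]; norm_num
    have h2 : (2 : ℝ) ≤ 2 ^ p := by
      simpa using Real.rpow_le_rpow_of_exponent_le (by norm_num : (1 : ℝ) ≤ 2) hp.le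
    have : g (3 / 2) = 3 * 2 ^ p - 2 - 4 ^ p := by simp only [g]; norm_num
    rw [this, h4]; nlinarith
  have hb : 0 < g 2 := by
    have e : g 2 = 3 * 3 ^ p - 2 - 5 ^ p := by simp only [g]; norm_num
    have h1 : (1 + (-(8 / 9)) : ℝ) ^ (p / 2) < 1 + (p / 2) * (-(8 / 9)) :=
      rpow_one_add_lt_one_add_mul_self (by norm_num) (by norm_num) (by linarith) (by linarith)
    have h2 : (1 + 16 / 9 : ℝ) ^ (p / 2) < 1 + (p / 2) * (16 / 9) :=
      rpow_one_add_lt_one_add_mul_self (by norm_num) (by norm_num) (by linarith) (by linarith)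
    have e1 : (1 + (-(8 / 9)) : ℝ) ^ (p / 2) = (1 / 3) ^ p := by
      have : (1 + (-(8 / 9)) : ℝ) = (1 / 3) ^ (2 : ℝ) := by norm_num
      rw [this, ← Real.rpow_mul (by norm_num)]; congr 1; ring
    have e2 : (1 + 16 / 9 : ℝ) ^ (p / 2) = (5 / 3) ^ p := by
      have : (1 + 16 / 9 : ℝ) = (5 / 3) ^ (2 : ℝ) := by norm_num
      rw [this, ← Real.rpow_mul (by norm_num)]; congr 1; ring
    rw [e1, Real.div_rpow (by norm_num) (by norm_num), Real.one_rpow] at h1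
    rw [e2, Real.div_rpow (by norm_num) (by norm_num)] at h2
    have h3 : (0 : ℝ) < 3 ^ p := by positivity
    have h4 : 2 * (1 / (3 : ℝ) ^ p) + 5 ^ p / 3 ^ p < 3 := by linarith
    have h5 : 2 * (1 / (3 : ℝ) ^ p) + 5 ^ p / 3 ^ p = (2 + 5 ^ p) / 3 ^ p := by ring
    rw [h5, div_lt_iff₀ h3] at h4
    rw [e]; linarith
  obtain ⟨t, ht, h0⟩ := intermediate_value_Icc (by norm_num : (3 / 2 : ℝ) ≤ 2) hg.continuousOn
    (show (0 : ℝ) ∈ Set.Icc _ _ from ⟨ha, hb.le⟩)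
  refine ⟨t, ht.1, lt_of_le_of_ne ht.2 ?_, ?_⟩
  · rintro rfl; linarith
  · simp only [g] at h0; linarith

lemma l3_sum_le (p : ℝ) (hp : 1 < p) [Fact (1 ≤ ENNReal.ofReal p)] (x : L3 p) :
    |x 0| + |x 1| + |x 2| ≤ 3 / 3 ^ (1 / p) * ‖x‖ := by
  have h := Real.rpow_sum_le_const_mul_sum_rpow (Finset.univ : Finset (Fin 3)) (fun i => x i) hp.le
  simp only [Fin.sum_univ_three, Finset.card_univ, Fintype.card_fin] at h
  have h2 := Real.rpow_le_rpow (by positivity) h (by positivity : 0 ≤ 1 / p)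
  rw [← Real.rpow_mul (by positivity), mul_one_div_cancel (by linarith), Real.rpow_one,
    Real.mul_rpow (by positivity) (by positivity), ← l3_norm p hp, ← Real.rpow_mul (by positivity)]
    at h2
  have e : (p - 1) * (1 / p) = 1 - 1 / p := by field_simp
  rw [e, Real.rpow_sub (by norm_num), Real.rpow_one] at h2
  exact_mod_cast h2

def vec (p : ℝ) (a b c : ℝ) : L3 p := WithLp.toLp _ ![a, b, c]

def fn (p : ℝ) [Fact (1 ≤ ENNReal.ofReal p)] (a b c : ℝ) : L3 p →L[ℝ] ℝ :=
  a • PiLp.proj _ (fun _ : Fin 3 => ℝ) 0 + b • PiLp.proj _ (fun _ : Fin 3 => ℝ) 1 +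
    c • PiLp.proj _ (fun _ : Fin 3 => ℝ) 2

lemma fn_apply (p : ℝ) [Fact (1 ≤ ENNReal.ofReal p)] (a b c : ℝ) (x : L3 p) :
    fn p a b c x = a * x 0 + b * x 1 + c * x 2 := by
  simp [fn]

lemma fn_norm (p : ℝ) (hp : 1 < p) [Fact (1 ≤ ENNReal.ofReal p)] (a b c M : ℝ)
    (ha : |a| ≤ M) (hb : |b| ≤ M) (hc : |c| ≤ M) (hM : M * (3 / 3 ^ (1 / p)) ≤ 1) :
    ‖fn p a b c‖ ≤ 1 := by
  refine ContinuousLinearMap.opNorm_le_bound _ (by norm_num) fun x => ?_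
  rw [fn_apply, Real.norm_eq_abs]
  have hM0 : 0 ≤ M := (abs_nonneg a).trans ha
  calc |a * x 0 + b * x 1 + c * x 2| ≤ |a| * |x 0| + |b| * |x 1| + |c| * |x 2| := by
        simp only [← abs_mul]; exact abs_add_three _ _ _
    _ ≤ M * |x 0| + M * |x 1| + M * |x 2| := by gcongr
    _ = M * (|x 0| + |x 1| + |x 2|) := by ring
    _ ≤ M * (3 / 3 ^ (1 / p) * ‖x‖) := by gcongr; exact l3_sum_le p hp x
    _ = (M * (3 / 3 ^ (1 / p))) * ‖x‖ := by ring
    _ ≤ 1 * ‖x‖ := by gcongr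

lemma l3_cube (p : ℝ) (hp : 2 ≤ p) [Fact (1 ≤ ENNReal.ofReal p)] :
    ∃ S : Finset (L3 p), S.card = 8 ∧ (S : Set (L3 p)) ⊆ sphere 0 1 ∧ ∃ d : ℝ, 1 < d ∧
      IsBSA (S : Set (L3 p)) d := by
  have hp1 : 1 < p := by linarith
  set K : ℝ := 3 ^ (1 / p) with hK
  have hK0 : 0 < K := by positivity
  have hKp : K ^ p = 3 := by
    rw [hK, ← Real.rpow_mul (by norm_num), one_div_mul_cancel (by linarith), Real.rpow_one]
  have hK2 : K < 2 := by
    by_contra! hh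
    have h1 : (2 : ℝ) ^ p ≤ K ^ p := Real.rpow_le_rpow (by norm_num) hh (by linarith)
    have h2 : (2 : ℝ) ^ (2 : ℝ) ≤ 2 ^ p := Real.rpow_le_rpow_of_exponent_le (by norm_num) hp
    norm_num at h2
    linarith
  refine bsa_of_frame ![vec p (1 / K) 0 0, vec p 0 (1 / K) 0, vec p 0 0 (1 / K)]
    (fun i => PiLp.proj _ (fun _ : Fin 3 => ℝ) i) (1 / K) ?_ ?_ ?_ ?_
  · exact one_div_lt_one_div_of_lt hK0 hK2
  · intro i
    refine ContinuousLinearMap.opNorm_le_bound _ (by norm_num) fun x => ?_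
    simpa using PiLp.norm_apply_le x i
  · intro i j
    fin_cases i <;> fin_cases j <;> simp [vec]
  · intro b
    have hs : ∀ b : Bool, |sg b * (1 / K)| ^ p = 1 / 3 := by
      intro b
      have : |sg b * (1 / K)| = 1 / K := by
        rw [abs_mul, abs_of_pos (by positivity : 0 < 1 / K)]
        cases b <;> norm_num [sg]
      rw [this, Real.div_rpow (by norm_num) hK0.le, hKp, Real.one_rpow]
    rw [l3_norm p hp1]
    have h0 := hs (b 0)
    have h1 := hs (b 1)
    have h2 := hs (b 2)
    simp only [Fin.sum_univ_three]
    simp [vec] at h0 h1 h2 ⊢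
    rw [h0, h1, h2]; norm_num

lemma l3_skew (p : ℝ) (hp : 1 < p) (hp2 : p < 2) [Fact (1 ≤ ENNReal.ofReal p)] :
    ∃ S : Finset (L3 p), S.card = 8 ∧ (S : Set (L3 p)) ⊆ sphere 0 1 ∧ ∃ d : ℝ, 1 < d ∧
      IsBSA (S : Set (L3 p)) d := by
  obtain ⟨t, ht1, ht2, ht⟩ := exists_t p hp hp2
  set K : ℝ := 3 ^ (1 / p) with hK
  have hK0 : 0 < K := by positivity
  have hKp : K ^ p = 3 := by
    rw [hK, ← Real.rpow_mul (by norm_num), one_div_mul_cancel (by linarith), Real.rpow_one]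
  set R : ℝ := K * (2 * t - 1) with hR
  have h21 : 0 < 2 * t - 1 := by linarith
  have ht0 : 0 < t := by linarith
  have hR0 : 0 < R := by positivity
  have hRp : R ^ p = 3 * (2 * t - 1) ^ p := by
    rw [hR, Real.mul_rpow hK0.le h21.le, hKp]
  set l : ℝ := K / (3 * t) with hl
  have hl0 : 0 < l := by positivity
  have hM : (l * t) * (3 / 3 ^ (1 / p)) ≤ 1 := by
    rw [← hK, hl]; apply le_of_eq; field_simp
  have hb1 : |l * (t - 1)| ≤ l * t := by
    rw [abs_of_nonneg (mul_nonneg hl0.le (by linarith))]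
    gcongr; linarith
  have hb2 : |-(l * t)| ≤ l * t := by
    rw [abs_neg, abs_of_nonneg (by positivity)]
  refine bsa_of_frame
    ![vec p (1 / R) (-t / R) (-t / R), vec p (-t / R) (1 / R) (-t / R),
      vec p (-t / R) (-t / R) (1 / R)]
    ![fn p (l * (t - 1)) (-(l * t)) (-(l * t)), fn p (-(l * t)) (l * (t - 1)) (-(l * t)),
      fn p (-(l * t)) (-(l * t)) (l * (t - 1))] ((t + 1) / (3 * t)) ?_ ?_ ?_ ?_
  · rw [div_lt_div_iff₀ (by norm_num) (by positivity)]; linarith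
  · intro i
    fin_cases i
    · exact fn_norm p hp _ _ _ _ hb1 hb2 hb2 hM
    · exact fn_norm p hp _ _ _ _ hb2 hb1 hb2 hM
    · exact fn_norm p hp _ _ _ _ hb2 hb2 hb1 hM
  · have e1 : l * (t - 1) * (1 / R) + -(l * t) * (-t / R) + -(l * t) * (-t / R)
        = (t + 1) / (3 * t) := by
      have e0 : l * (t - 1) * (1 / R) + -(l * t) * (-t / R) + -(l * t) * (-t / R)
          = l * ((2 * t - 1) * (t + 1)) / R := by ring
      rw [e0, hl, hR]
      generalize 2 * t - 1 = w at h21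
      field_simp
    have e2 : l * (t - 1) * (-t / R) + -(l * t) * (1 / R) + -(l * t) * (-t / R) = 0 := by
      field_simp; ring
    intro i j
    fin_cases i <;> fin_cases j <;> simp [vec, fn_apply] <;>
      first | linear_combination e1 | linear_combination e2
  · intro b
    have hA : (1 + 2 * t) ^ p = 3 * (2 * t - 1) ^ p - 2 := by linarith
    have q0 : (0 : ℝ) < (2 * t - 1) ^ p := by positivity
    have n1 : |1 / R| ^ p = 1 / R ^ p := by
      rw [abs_of_pos (by positivity), Real.div_rpow (by norm_num) hR0.le, Real.one_rpow]
    have n2 : |(2 * t - 1) / R| ^ p = 1 / 3 := by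
      rw [abs_of_pos (by positivity), Real.div_rpow h21.le hR0.le, hRp]; field_simp
    have n3 : |(1 + 2 * t) / R| ^ p = (3 * (2 * t - 1) ^ p - 2) / R ^ p := by
      rw [abs_of_pos (by positivity), Real.div_rpow (by positivity) hR0.le, hA]
    have s1 : ∀ x : ℝ, x = 1 / R ∨ x = -(1 / R) → |x| ^ p = 1 / R ^ p := by
      rintro x (rfl | rfl) <;> simp only [abs_neg, n1]
    have s2 : ∀ x : ℝ, x = (2 * t - 1) / R ∨ x = -((2 * t - 1) / R) → |x| ^ p = 1 / 3 := by
      rintro x (rfl | rfl) <;> simp only [abs_neg, n2]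
    have s3 : ∀ x : ℝ, x = (1 + 2 * t) / R ∨ x = -((1 + 2 * t) / R) →
        |x| ^ p = (3 * (2 * t - 1) ^ p - 2) / R ^ p := by
      rintro x (rfl | rfl) <;> simp only [abs_neg, n3]
    have tot : 1 / R ^ p + 1 / R ^ p + (3 * (2 * t - 1) ^ p - 2) / R ^ p = 1 := by
      rw [hRp]; field_simp; ring
    have main : ∀ y : L3 p, (|y 0| ^ p + |y 1| ^ p + |y 2| ^ p = 1) → ‖y‖ = 1 := by
      intro y hy; rw [l3_norm p hp, hy, Real.one_rpow]
    apply main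
    have c0 : (∑ i, sg (b i) • (![vec p (1 / R) (-t / R) (-t / R), vec p (-t / R) (1 / R) (-t / R),
      vec p (-t / R) (-t / R) (1 / R)] : Fin 3 → L3 p) i) 0
        = (sg (b 0) - t * sg (b 1) - t * sg (b 2)) / R := by
      simp [Fin.sum_univ_three, vec]; ring
    have c1 : (∑ i, sg (b i) • (![vec p (1 / R) (-t / R) (-t / R), vec p (-t / R) (1 / R) (-t / R),
      vec p (-t / R) (-t / R) (1 / R)] : Fin 3 → L3 p) i) 1
        = (sg (b 1) - t * sg (b 0) - t * sg (b 2)) / R := by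
      simp [Fin.sum_univ_three, vec]; ring
    have c2 : (∑ i, sg (b i) • (![vec p (1 / R) (-t / R) (-t / R), vec p (-t / R) (1 / R) (-t / R),
      vec p (-t / R) (-t / R) (1 / R)] : Fin 3 → L3 p) i) 2
        = (sg (b 2) - t * sg (b 0) - t * sg (b 1)) / R := by
      simp [Fin.sum_univ_three, vec]; ring
    rw [c0, c1, c2]
    have gen : ∀ x y z : Bool, y = z → x = y →
        |(sg x - t * sg y - t * sg z) / R| ^ p = 1 / 3 := by
      rintro x y z rfl rfl
      apply s2; cases x
      · left; simp [sg]; ring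
      · right; simp [sg]; ring
    have gen2 : ∀ x y z : Bool, y = z → x ≠ y →
        |(sg x - t * sg y - t * sg z) / R| ^ p = (3 * (2 * t - 1) ^ p - 2) / R ^ p := by
      rintro x y z rfl hxy
      apply s3
      cases x <;> cases y <;> simp [sg] at hxy ⊢
      · right; ring
      · left; ring
    have gen3 : ∀ x y z : Bool, y ≠ z →
        |(sg x - t * sg y - t * sg z) / R| ^ p = 1 / R ^ p := by
      intro x y z hyz
      apply s1
      cases x <;> cases y <;> cases z <;> simp [sg] at hyz ⊢
      all_goals first | (left; ring1) | (right; ring1)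
    by_cases h01 : b 0 = b 1
    · by_cases h12 : b 1 = b 2
      · rw [gen _ _ _ h12 h01, gen _ _ _ (h01.trans h12) h01.symm,
          gen _ _ _ h01 (h01.trans h12).symm]; norm_num
      · rw [gen3 _ _ _ h12, gen3 _ _ _ (h01 ▸ h12), gen2 _ _ _ h01 (fun e => h12 (by rw [e, h01]))]
        exact tot
    · by_cases h12 : b 1 = b 2
      · rw [gen2 _ _ _ h12 h01, gen3 _ _ _ (h12 ▸ h01), gen3 _ _ _ h01]; linarith
      · have h02 : b 0 = b 2 := by
          revert h01 h12; cases b 0 <;> cases b 1 <;> cases b 2 <;> simp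
        rw [gen3 _ _ _ h12, gen2 _ _ _ h02 (Ne.symm h01), gen3 _ _ _ h01]; linarith

/-- For every `1 < p < ∞`, `H'_α(ℓ_p^3) = 2³ = 8`: there exist `8`
points on the unit sphere of `ℓ_p^3` forming a bounded and separated antipodal set with
some constant `d > 1`, and `8` is the largest possible cardinality of such a set. -/
theorem strictHalpha_lp3_eq_eight (p : ℝ) (hp : 1 < p) [Fact (1 ≤ ENNReal.ofReal p)] :
    (∃ S : Finset (PiLp (ENNReal.ofReal p) (fun _ : Fin 3 => ℝ)),
      S.card = 8 ∧
      (S : Set (PiLp (ENNReal.ofReal p) (fun _ : Fin 3 => ℝ))) ⊆ sphere 0 1 ∧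
      ∃ d : ℝ, 1 < d ∧
        IsBSA (S : Set (PiLp (ENNReal.ofReal p) (fun _ : Fin 3 => ℝ))) d) ∧
    strictHalpha (PiLp (ENNReal.ofReal p) (fun _ : Fin 3 => ℝ)) = 8 := by
  have hex : ∃ S : Finset (L3 p), S.card = 8 ∧ (S : Set (L3 p)) ⊆ sphere 0 1 ∧ ∃ d : ℝ, 1 < d ∧
      IsBSA (S : Set (L3 p)) d := by
    rcases lt_or_ge p 2 with h | h
    · exact l3_skew p hp h
    · exact l3_cube p h
  refine ⟨hex, ?_⟩
  apply IsGreatest.csSup_eq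
  constructor
  · obtain ⟨S, hc, hs, d, hd, -, h⟩ := hex
    refine ⟨S, hc, hs, fun x hx y hy hxy => ?_⟩
    obtain ⟨f, h1, h2, h3⟩ := h x hx y hy hxy
    exact ⟨f, h1, by linarith, h3⟩
  · rintro k ⟨S, rfl, hs, h⟩
    exact l3_upper p hp S hs h

end
end
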